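/- Let $m\in\mathbb N$, let $s\in(0,1]$ be fixed, let $K\subseteq\mathbb R^m$ be a nonempty convex set, and let $\vartheta:K\times[0,1]\to\mathbb R$. Let $\hslash:K\to\mathbb R$ be a nonnegative differentiable function with gradient $\nabla\hslash$ (differentiability and gradient are understood relative to $K$, i.e. $\hslash(x)=\hslash(b)+\langle\nabla\hslash(b),x-b\rangle+o(\|x-b\|)$ as $x\to b$ in $K$, for every $b\in K$). Assume that $\hslash$ is general $s$-convex with respect to $\vartheta$, that is, for all $b_1,b_2\in K$ and all $\sigma\in[0,1]$, $$\hslash(\sigma b_1+(1-\sigma)b_2)\le\sigma^s[\hslash(b_1)+\vartheta(b_1,\sigma)]+(1-\sigma)^s[\hslash(b_2)+\vartheta(b_2,\sigma)]+\vartheta\left(\tfrac{b_1+b_2}{2},\sigma\right).$$ Let $b_1,b_2\in K$, and put $r(\sigma)=\hslash(b_2+\sigma(b_1-b_2))-\hslash(b_2)-\sigma\langle\nabla\hslash(b_2),b_1-b_2\rangle$. Suppose that the limit $$L=\lim_{\sigma\to0^+}\frac{\vartheta\left(\frac{b_1+b_2}{2},\sigma\right)}{\sigma}$$ exists in $\mathbb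 R$ and that $$\frac{\vartheta\left(\frac{b_1+b_2}{2},\sigma\right)+\vartheta(b_2,\sigma)-r(\sigma)}{\sigma}\le L\qquad\text{for every }\sigma\in(0,1].$$ Then for every $\sigma\in(0,1]$, $$\langle\nabla\hslash(b_2),b_1-b_2\rangle\le\sigma^{s-1}[\hslash(b_1)-\hslash(b_2)+\vartheta(b_1,\sigma)-\vartheta(b_2,\sigma)]+\frac{\hslash(b_2)}{\sigma}+\frac{\vartheta(b_2,\sigma)}{\sigma}+L.$$ -/

import Mathlib

open Set Filter
open scoped RealInnerProductSpace Topology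

/-- A real-valued function `g` on a set `K ⊆ ℝ^m` is general `s`-convex with respect to a map
`ϑ : K × [0,1] → ℝ` if for all `b₁, b₂ ∈ K` and all `σ ∈ [0,1]`,
`g(σb₁ + (1−σ)b₂) ≤ σ^s (g b₁ + ϑ(b₁,σ)) + (1−σ)^s (g b₂ + ϑ(b₂,σ)) + ϑ((b₁+b₂)/2, σ)`.
For convex `K` only the values of `g` on `K` and of `ϑ` on `K × [0,1]` are used. -/
def GeneralSConvexOn {m : ℕ} (s : ℝ) (K : Set (EuclideanSpace ℝ (Fin m)))
    (g : EuclideanSpace ℝ (Fin m) → ℝ) (ϑ : EuclideanSpace ℝ (Fin m) → ℝ → ℝ) : Prop :=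
  ∀ b₁ ∈ K, ∀ b₂ ∈ K, ∀ σ ∈ Icc (0 : ℝ) 1,
    g (σ • b₁ + (1 - σ) • b₂) ≤
      σ ^ s * (g b₁ + ϑ b₁ σ) + (1 - σ) ^ s * (g b₂ + ϑ b₂ σ) +
        ϑ ((1 / 2 : ℝ) • (b₁ + b₂)) σ

/-- The first-order Taylor remainder of `g` at `b₂` in the direction of `b₁`, where `v` is the
gradient of `g` at `b₂`: `r(σ) = g(b₂ + σ(b₁−b₂)) − g(b₂) − σ⟨v, b₁−b₂⟩`. -/
noncomputable def taylorRemainder {m : ℕ} (g : EuclideanSpace ℝ (Fin m) → ℝ)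
    (v b₁ b₂ : EuclideanSpace ℝ (Fin m)) (σ : ℝ) : ℝ :=
  g (b₂ + σ • (b₁ - b₂)) - g b₂ - σ * ⟪v, b₁ - b₂⟫

/-- The limit assumption for the ordered pair `(b₁, b₂)`, with limit `L`, where `v` is the
gradient of `g` at `b₂`: `ϑ((b₁+b₂)/2, σ)/σ → L` as `σ → 0⁺`, and `L` bounds
`(ϑ((b₁+b₂)/2, σ) + ϑ(b₂,σ) − r(σ))/σ` from above for every `σ ∈ (0,1]`. -/
def LimitAssumption {m : ℕ} (g : EuclideanSpace ℝ (Fin m) → ℝ)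
    (ϑ : EuclideanSpace ℝ (Fin m) → ℝ → ℝ)
    (v b₁ b₂ : EuclideanSpace ℝ (Fin m)) (L : ℝ) : Prop :=
  Tendsto (fun σ : ℝ => ϑ ((1 / 2 : ℝ) • (b₁ + b₂)) σ / σ) (𝓝[>] (0 : ℝ)) (𝓝 L) ∧
  ∀ σ ∈ Ioc (0 : ℝ) 1,
    (ϑ ((1 / 2 : ℝ) • (b₁ + b₂)) σ + ϑ b₂ σ - taylorRemainder g v b₁ b₂ σ) / σ ≤ L

/-- Nonnegativity of `g` forces `g b + ϑ(b, σ) ≥ 0`: take `b₁ = b₂ = b` in the definition. -/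
theorem GeneralSConvexOn.add_nonneg {m : ℕ} {s : ℝ} {K : Set (EuclideanSpace ℝ (Fin m))}
    {g : EuclideanSpace ℝ (Fin m) → ℝ} {ϑ : EuclideanSpace ℝ (Fin m) → ℝ → ℝ}
    (h : GeneralSConvexOn s K g ϑ) {b : EuclideanSpace ℝ (Fin m)} (hb : b ∈ K) (hg : 0 ≤ g b)
    {σ : ℝ} (hσ : σ ∈ Icc (0 : ℝ) 1) : 0 ≤ g b + ϑ b σ := by
  have key := h b hb b hb σ hσ
  have e₁ : σ • b + (1 - σ) • b = b := by module
  have e₂ : (1 / 2 : ℝ) • (b + b) = b := by module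
  rw [e₁, e₂] at key
  have p : 0 ≤ σ ^ s := Real.rpow_nonneg hσ.1 s
  have q : 0 ≤ (1 - σ) ^ s := Real.rpow_nonneg (sub_nonneg.2 hσ.2) s
  by_contra! hlt
  linarith [mul_nonneg p (neg_nonneg.2 hlt.le), mul_nonneg q (neg_nonneg.2 hlt.le)]

theorem gradient_ineq_b {m : ℕ} (s : ℝ) (hs : s ∈ Ioc (0 : ℝ) 1)
    (K : Set (EuclideanSpace ℝ (Fin m))) (hK : Convex ℝ K)
    (ℏ : EuclideanSpace ℝ (Fin m) → ℝ) (ϑ : EuclideanSpace ℝ (Fin m) → ℝ → ℝ)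
    (grad : EuclideanSpace ℝ (Fin m) → EuclideanSpace ℝ (Fin m))
    (hnn : ∀ b ∈ K, 0 ≤ ℏ b)
    (hdiff : ∀ b ∈ K, HasGradientWithinAt ℏ (grad b) K b)
    (hconv : GeneralSConvexOn s K ℏ ϑ)
    (b₁ : EuclideanSpace ℝ (Fin m)) (hb₁ : b₁ ∈ K)
    (b₂ : EuclideanSpace ℝ (Fin m)) (hb₂ : b₂ ∈ K) (L : ℝ)
    (hlim : LimitAssumption ℏ ϑ (grad b₂) b₁ b₂ L) :
    ∀ σ ∈ Ioc (0 : ℝ) 1,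
      ⟪grad b₂, b₁ - b₂⟫ ≤
        σ ^ (s - 1) * (ℏ b₁ - ℏ b₂ + ϑ b₁ σ - ϑ b₂ σ) + ℏ b₂ / σ + ϑ b₂ σ / σ + L := by
  rintro σ ⟨hσ₀, hσ₁⟩
  have hσ : σ ∈ Icc (0 : ℝ) 1 := ⟨hσ₀.le, hσ₁⟩
  have hpos : 0 ≤ ℏ b₂ + ϑ b₂ σ := hconv.add_nonneg hb₂ (hnn b₂ hb₂) hσ
  have key := hconv b₁ hb₁ b₂ hb₂ σ hσ
  have e : σ • b₁ + (1 - σ) • b₂ = b₂ + σ • (b₁ - b₂) := by module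
  rw [e] at key
  have hL := hlim.2 σ ⟨hσ₀, hσ₁⟩
  rw [div_le_iff₀ hσ₀, taylorRemainder] at hL
  have p : σ ^ s ≤ 1 := Real.rpow_le_one hσ₀.le hσ₁ hs.1.le
  have q : (1 - σ) ^ s ≤ 1 := Real.rpow_le_one (by linarith) (by linarith) hs.1.le
  have hc : 0 ≤ (2 - σ ^ s - (1 - σ) ^ s) * (ℏ b₂ + ϑ b₂ σ) :=
    mul_nonneg (by linarith) hpos
  have hrhs : σ ^ (s - 1) * (ℏ b₁ - ℏ b₂ + ϑ b₁ σ - ϑ b₂ σ) + ℏ b₂ / σ + ϑ b₂ σ / σ + L =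
      (σ ^ s * (ℏ b₁ - ℏ b₂ + ϑ b₁ σ - ϑ b₂ σ) + ℏ b₂ + ϑ b₂ σ + L * σ) / σ := by
    rw [Real.rpow_sub_one hσ₀.ne']
    field_simp
  rw [hrhs, le_div_iff₀ hσ₀]
  linarith
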